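/- Let 0 < μ ≤ 4d, set M := 12(4d/μ)², and suppose the even sidelength satisfies L ≥ 2M. Let Ω ⊆ Λ and let V : Ω → ℝ satisfy μ/2 ≤ V(x) ≤ μ for all x ∈ Ω; let Δ_Ω := P_Ω Δ P_Ω and let χ be the spectral projection of the hermitian matrix -Δ_Ω - V (with V extended by zero and viewed as a diagonal matrix) onto its strictly negative eigenvalues. Then for every x ∈ Ω at ℓ^∞-distance strictly greater than 2M from Λ∖Ω, the diagonal entry satisfies χ_{x,x} ≥ κ(μ), where κ(μ) := μ^d/(4^{2d+1} e^d d^d) · [1 + 2 ln(2)(d^{-1}+1) + ln(4dμ^{-1})]^{-2d}. -/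

import Mathlib

open Matrix
open scoped BigOperators Classical ComplexOrder

noncomputable section

/-- The discrete torus `Λ = (ℤ/Lℤ)^d`. -/
abbrev Lam (d L : ℕ) : Type := Fin d → ZMod L

/-- `x` and `y` are nearest neighbors on the torus (ℓ¹-distance 1). -/
def isNN {d L : ℕ} (x y : Lam d L) : Prop :=
  ∃ ν : Fin d, (x ν = y ν + 1 ∨ x ν + 1 = y ν) ∧ ∀ μ : Fin d, μ ≠ ν → x μ = y μ

/-- The discrete Laplacian `Δ = T - 2d·Id` on the torus. -/
def lap (d L : ℕ) : Matrix (Lam d L) (Lam d L) ℂ :=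
  (Matrix.of fun x y => if isNN x y then (1 : ℂ) else 0) - (2 * (d : ℂ)) • 1

/-- A one-particle density matrix: hermitian with `0 ≤ γ ≤ 1` as quadratic forms. -/
def IsDM {d L : ℕ} [NeZero L] (γ : Matrix (Lam d L) (Lam d L) ℂ) : Prop :=
  γ.PosSemidef ∧ (1 - γ).PosSemidef

/-- `Tr{[X]_-}`: the sum of the negative eigenvalues of a hermitian matrix `X`
(junk value `0` if `X` is not hermitian). -/
def negTrace {n : Type} [Fintype n] [DecidableEq n] (X : Matrix n n ℂ) : ℝ :=
  if hX : X.IsHermitian then ∑ i, min (hX.eigenvalues i) 0 else 0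

/-- The HFz energy functional. -/
def hfzE {d L : ℕ} [NeZero L] (μ U : ℝ) (γu γd : Matrix (Lam d L) (Lam d L) ℂ) : ℝ :=
  (((-(lap d L) - (μ : ℂ) • 1) * (γu + γd)).trace).re
    + U * ∑ x, (γu x x).re * (γd x x).re

/-- The set of HFz energy values over pairs of one-particle density matrices. -/
def hfzEnergies (d L : ℕ) [NeZero L] (μ U : ℝ) : Set ℝ :=
  { E | ∃ γu γd : Matrix (Lam d L) (Lam d L) ℂ, IsDM γu ∧ IsDM γd ∧ hfzE μ U γu γd = E }

/-- The diagonal orthogonal projection `P_A` onto the coordinates in `A`. -/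
def proj {d L : ℕ} (A : Set (Lam d L)) : Matrix (Lam d L) (Lam d L) ℂ :=
  Matrix.diagonal fun x => if x ∈ A then 1 else 0

/-- The boundary `∂Ω := {x ∈ Ω : x has a nearest neighbor outside Ω}`. -/
def bdry {d L : ℕ} (Ω : Set (Lam d L)) : Set (Lam d L) :=
  {x | x ∈ Ω ∧ ∃ y, y ∉ Ω ∧ isNN x y}

/-- The spectral projection `1[X < μ]` of a hermitian matrix `X` onto `(-∞, μ)`
(junk value `0` if `X` is not hermitian). -/
def specProjLt {n : Type} [Fintype n] [DecidableEq n] (X : Matrix n n ℂ) (μ : ℝ) :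
    Matrix n n ℂ :=
  if hX : X.IsHermitian then
    (hX.eigenvectorUnitary : Matrix n n ℂ) *
      Matrix.diagonal (fun i => if hX.eigenvalues i < μ then (1 : ℂ) else 0) *
      (star (hX.eigenvectorUnitary : Matrix n n ℂ))
  else 0

/-- The torus distance between two elements of `ℤ/Lℤ`. -/
def torusDist {L : ℕ} [NeZero L] (a b : ZMod L) : ℕ := min (a - b).val (b - a).val

/-- The torus `ℓ^∞`-distance on `Λ = (ℤ/Lℤ)^d`. -/
def distInf {d L : ℕ} [NeZero L] (x y : Lam d L) : ℕ :=
  Finset.univ.sup fun ν => torusDist (x ν) (y ν)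

/-- `M_*(μ) := 12 (4d/μ)²`. -/
def Mstar (d : ℕ) (μ : ℝ) : ℝ := 12 * (4 * d / μ) ^ 2

/-- `κ(μ) := μ^d/(4^{2d+1} e^d d^d) · [1 + 2 ln 2 (d⁻¹+1) + ln(4d/μ)]^{-2d}`. -/
def kappaConst (d : ℕ) (μ : ℝ) : ℝ :=
  μ ^ d / (4 ^ (2 * d + 1) * Real.exp 1 ^ d * (d : ℝ) ^ d *
    (1 + 2 * Real.log 2 * ((d : ℝ)⁻¹ + 1) + Real.log (4 * d / μ)) ^ (2 * d))

lemma Matrix.IsHermitian.one_sub_smul_pow_eq {n : Type} [Fintype n] [DecidableEq n]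
    {X : Matrix n n ℂ} (hX : X.IsHermitian) (c : ℝ) (k : ℕ) :
    (1 - (c : ℂ) • X) ^ k = (hX.eigenvectorUnitary : Matrix n n ℂ) *
      Matrix.diagonal (fun i => (((1 - c * hX.eigenvalues i) ^ k : ℝ) : ℂ)) *
      star (hX.eigenvectorUnitary : Matrix n n ℂ) := by
  have hU : star (hX.eigenvectorUnitary : Matrix n n ℂ) * hX.eigenvectorUnitary = 1 :=
    Unitary.coe_star_mul_self _
  have hU' : (hX.eigenvectorUnitary : Matrix n n ℂ) *
      star (hX.eigenvectorUnitary : Matrix n n ℂ) = 1 :=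
    Unitary.coe_mul_star_self _
  have h1 : 1 - (c : ℂ) • X = (hX.eigenvectorUnitary : Matrix n n ℂ) *
      Matrix.diagonal (fun i => ((1 - c * hX.eigenvalues i : ℝ) : ℂ)) *
      star (hX.eigenvectorUnitary : Matrix n n ℂ) := by
    have hs := hX.spectral_theorem
    rw [Unitary.conjStarAlgAut_apply] at hs
    have hdiag : Matrix.diagonal (fun i => ((1 - c * hX.eigenvalues i : ℝ) : ℂ)) =
        (1 : Matrix n n ℂ) - (c : ℂ) • Matrix.diagonal (RCLike.ofReal ∘ hX.eigenvalues) := by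
      ext i j
      by_cases hij : i = j
      · subst hij; simp
      · simp [hij]
    rw [hdiag, mul_sub, sub_mul, mul_one, hU', mul_smul_comm, smul_mul_assoc]
    conv_lhs => rw [hs]
  induction k with
  | zero => simp [hU']
  | succ k ih =>
    rw [pow_succ, ih, h1]
    simp only [mul_assoc]
    rw [← mul_assoc (star (hX.eigenvectorUnitary : Matrix n n ℂ)) _ (_ * _), hU, one_mul,
      ← mul_assoc (Matrix.diagonal _) (Matrix.diagonal _), Matrix.diagonal_mul_diagonal]
    simp only [pow_succ, Complex.ofReal_mul]

lemma Matrix.mul_diagonal_mul_star_apply_self_re {n : Type} [Fintype n] [DecidableEq n]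
    (U : Matrix n n ℂ) (D : n → ℝ) (x : n) :
    ((U * Matrix.diagonal (fun i => (D i : ℂ)) * star U) x x).re =
      ∑ i, Complex.normSq (U x i) * D i := by
  rw [Matrix.mul_apply, Complex.re_sum]
  refine Finset.sum_congr rfl fun i _ => ?_
  rw [Matrix.mul_diagonal, Matrix.star_apply, mul_right_comm, Complex.star_def, Complex.mul_conj,
    ← Complex.ofReal_mul, Complex.ofReal_re]

/-- A power of `1 - c X` is dominated on the diagonal by the negative spectral projection. -/
lemma re_one_sub_smul_pow_apply_le {n : Type} [Fintype n] [DecidableEq n]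
    {X : Matrix n n ℂ} (hX : X.IsHermitian) {μ c : ℝ} (hc : 0 ≤ c)
    (hlow : ∀ i, -μ ≤ hX.eigenvalues i) (hup : ∀ i, c * hX.eigenvalues i ≤ 1) (k : ℕ) (x : n) :
    (((1 - (c : ℂ) • X) ^ k) x x).re ≤ 1 + (1 + c * μ) ^ k * (specProjLt X 0 x x).re := by
  have hchi : specProjLt X 0 = (hX.eigenvectorUnitary : Matrix n n ℂ) *
      Matrix.diagonal (fun i => ((if hX.eigenvalues i < 0 then 1 else 0 : ℝ) : ℂ)) *
      star (hX.eigenvectorUnitary : Matrix n n ℂ) := by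
    rw [specProjLt, dif_pos hX]
    congr 3
    ext i
    split_ifs <;> simp
  have hone : ∑ i, Complex.normSq ((hX.eigenvectorUnitary : Matrix n n ℂ) x i) * 1 = 1 := by
    rw [← Matrix.mul_diagonal_mul_star_apply_self_re _ (fun _ => 1)]
    simp
  rw [hX.one_sub_smul_pow_eq, hchi, Matrix.mul_diagonal_mul_star_apply_self_re,
    Matrix.mul_diagonal_mul_star_apply_self_re, Finset.mul_sum]
  refine le_of_le_of_eq ?_ (congrArg (· + _) hone)
  rw [← Finset.sum_add_distrib]
  refine Finset.sum_le_sum fun i _ => ?_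
  have hnn := Complex.normSq_nonneg ((hX.eigenvectorUnitary : Matrix n n ℂ) x i)
  rw [mul_left_comm, ← mul_add]
  refine mul_le_mul_of_nonneg_left ?_ hnn
  have h1 := hup i
  have h2 := mul_le_mul_of_nonneg_left (hlow i) hc
  split_ifs with h
  · have : (1 - c * hX.eigenvalues i) ^ k ≤ (1 + c * μ) ^ k :=
      pow_le_pow_left₀ (by linarith) (by linarith) k
    linarith
  · have h3 : 0 ≤ c * hX.eigenvalues i := mul_nonneg hc (not_lt.mp h)
    have : (1 - c * hX.eigenvalues i) ^ k ≤ 1 := pow_le_one₀ (by linarith) (by linarith)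
    linarith

/-- Iterating a subsolution inequality for a nonnegative symmetric matrix gives a lower bound on
the diagonal of its even powers. -/
lemma sq_pow_mul_le_pow_apply_self {n : Type} [Fintype n] [DecidableEq n]
    {K : Matrix n n ℝ} (hsymm : K.transpose = K) (hK : ∀ i j, 0 ≤ K i j) {f : n → ℝ}
    (hf : ∀ i, 0 ≤ f i) {ρ : ℝ} (hρ : 0 ≤ ρ) (hsub : ∀ i, ρ * f i ≤ ∑ j, K i j * f j)
    (m : ℕ) (x : n) :
    (ρ ^ m * f x) ^ 2 ≤ (K ^ (2 * m)) x x * ∑ i, f i ^ 2 := by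
  have hiter : ∀ (m : ℕ) (i : n), ρ ^ m * f i ≤ ∑ j, (K ^ m) i j * f j := by
    intro m
    induction m with
    | zero => intro i; simp [Matrix.one_apply]
    | succ m ih =>
      intro i
      calc ρ ^ (m + 1) * f i = ρ ^ m * (ρ * f i) := by ring
        _ ≤ ρ ^ m * ∑ j, K i j * f j := mul_le_mul_of_nonneg_left (hsub i) (pow_nonneg hρ m)
        _ = ∑ j, K i j * (ρ ^ m * f j) := by
          rw [Finset.mul_sum]; exact Finset.sum_congr rfl fun j _ => by ring
        _ ≤ ∑ j, K i j * ∑ l, (K ^ m) j l * f l :=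
          Finset.sum_le_sum fun j _ => mul_le_mul_of_nonneg_left (ih j) (hK i j)
        _ = ∑ l, (K ^ (m + 1)) i l * f l := by
          simp_rw [pow_succ' K m, Matrix.mul_apply, Finset.mul_sum, Finset.sum_mul]
          rw [Finset.sum_comm]
          exact Finset.sum_congr rfl fun l _ => Finset.sum_congr rfl fun j _ => by ring
  have hpow : (K ^ (2 * m)) x x = ∑ j, (K ^ m) x j ^ 2 := by
    have ht : (K ^ m).transpose = K ^ m := by rw [Matrix.transpose_pow, hsymm]
    rw [two_mul, pow_add, Matrix.mul_apply]
    refine Finset.sum_congr rfl fun j _ => ?_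
    rw [sq]
    congr 1
    rw [← Matrix.transpose_apply (K ^ m) x j, ht]
  calc (ρ ^ m * f x) ^ 2 ≤ (∑ j, (K ^ m) x j * f j) ^ 2 :=
        pow_le_pow_left₀ (mul_nonneg (pow_nonneg hρ m) (hf x)) (hiter m x) 2
    _ ≤ _ := by rw [hpow]; exact Finset.sum_mul_sq_le_sq_mul_sq _ _ _

/-- Semigroup bound: a positive subsolution `f` of `X f ≤ -ε f` forces the negative spectral
projection of `X ≥ -μ` to have a large diagonal entry. -/
lemma exp_mul_le_specProjLt {n : Type} [Fintype n] [DecidableEq n]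
    {H : Matrix n n ℝ} (hX : (H.map (fun r => (r : ℂ))).IsHermitian) (hsymm : H.transpose = H)
    (hoff : ∀ i j, i ≠ j → H i j ≤ 0) {μ ε : ℝ} (hε : 0 ≤ ε)
    (hlow : ∀ i, -μ ≤ hX.eigenvalues i) {f : n → ℝ} (hf : ∀ i, 0 ≤ f i)
    (hsub : ∀ i, ∑ j, H i j * f j ≤ -ε * f i) {x : n} (hfx : f x = 1) {t : ℝ} (ht : 0 ≤ t) :
    Real.exp (t * ε) ≤ (∑ i, f i ^ 2) *
      (1 + Real.exp (t * μ) * (specProjLt (H.map (fun r => (r : ℂ))) 0 x x).re) := by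
  have htend : Filter.Tendsto (fun m : ℕ => 2 * m) Filter.atTop Filter.atTop :=
    Filter.tendsto_atTop_mono (fun m => Nat.le_mul_of_pos_left m two_pos) Filter.tendsto_id
  have hexp : ∀ s : ℝ, Filter.Tendsto (fun m : ℕ => (1 + t / ((2 * m : ℕ) : ℝ) * s) ^ (2 * m))
      Filter.atTop (nhds (Real.exp (t * s))) := by
    intro s
    have := (Real.tendsto_one_add_div_pow_exp (t * s)).comp htend
    refine this.congr fun m => ?_
    simp only [Function.comp_apply]
    congr 2
    ring
  have hsmall : ∀ a : ℝ, ∀ᶠ m : ℕ in Filter.atTop, t / ((2 * m : ℕ) : ℝ) * a ≤ 1 := by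
    intro a
    have h0 : Filter.Tendsto (fun m : ℕ => t / ((2 * m : ℕ) : ℝ) * a) Filter.atTop (nhds 0) := by
      have := ((tendsto_const_div_atTop_nhds_zero_nat t).comp htend).mul_const a
      simpa using! this
    exact h0.eventually_le_const one_pos
  refine le_of_tendsto_of_tendsto (hexp ε) ((((hexp μ).mul_const _).const_add 1).const_mul _) ?_
  have hall1 : ∀ᶠ m : ℕ in Filter.atTop, ∀ i, t / ((2 * m : ℕ) : ℝ) * hX.eigenvalues i ≤ 1 :=
    Filter.eventually_all.2 fun i => hsmall _
  have hall2 : ∀ᶠ m : ℕ in Filter.atTop, ∀ i, t / ((2 * m : ℕ) : ℝ) * H i i ≤ 1 :=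
    Filter.eventually_all.2 fun i => hsmall _
  filter_upwards [hall1, hall2] with m h1 h2
  set c : ℝ := t / ((2 * m : ℕ) : ℝ) with hcdef
  have hc : 0 ≤ c := div_nonneg ht (Nat.cast_nonneg _)
  have hspec := re_one_sub_smul_pow_apply_le hX hc hlow h1 (2 * m) x
  have hmap : (1 - (c : ℂ) • H.map (fun r => (r : ℂ))) ^ (2 * m) =
      ((1 - c • H) ^ (2 * m)).map (fun r => (r : ℂ)) := by
    have h : (1 - (c : ℂ) • H.map (fun r => (r : ℂ))) =
        Complex.ofRealHom.mapMatrix (1 - c • H) := by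
      ext i j
      by_cases hij : i = j
      · subst hij; simp
      · simp [hij]
    rw [h, ← map_pow]
    rfl
  rw [hmap, Matrix.map_apply, Complex.ofReal_re] at hspec
  have hK : (1 - c • H).transpose = 1 - c • H := by
    rw [Matrix.transpose_sub, Matrix.transpose_smul, hsymm, Matrix.transpose_one]
  have hKnn : ∀ i j, 0 ≤ (1 - c • H) i j := by
    intro i j
    by_cases hij : i = j
    · subst hij
      have := h2 i
      simp only [Matrix.sub_apply, Matrix.one_apply_eq, Matrix.smul_apply, smul_eq_mul]
      linarith
    · have := mul_nonneg hc (neg_nonneg.2 (hoff i j hij))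
      simp only [Matrix.sub_apply, Matrix.one_apply_ne hij, Matrix.smul_apply, smul_eq_mul]
      linarith
  have hKsub : ∀ i, (1 + c * ε) * f i ≤ ∑ j, (1 - c • H) i j * f j := by
    intro i
    have : ∑ j, (1 - c • H) i j * f j = f i - c * ∑ j, H i j * f j := by
      simp [Matrix.one_apply, sub_mul, Finset.sum_sub_distrib, Finset.mul_sum, mul_assoc]
    rw [this]
    nlinarith [mul_le_mul_of_nonneg_left (hsub i) hc]
  have hlow' := sq_pow_mul_le_pow_apply_self hK hKnn hf
    (add_nonneg zero_le_one (mul_nonneg hc hε)) hKsub m x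
  rw [hfx, mul_one, ← pow_mul, mul_comm m 2] at hlow'
  calc (1 + c * ε) ^ (2 * m) ≤ _ := hlow'
    _ = (∑ i, f i ^ 2) * ((1 - c • H) ^ (2 * m)) x x := mul_comm _ _
    _ ≤ _ := mul_le_mul_of_nonneg_left hspec (Finset.sum_nonneg fun i _ => sq_nonneg _)

/-- The Dirichlet ground state of the interval `(-N, N)`, transplanted to the cycle `ℤ/Lℤ`. -/
def cycleGroundState (L N : ℕ) (a : ZMod L) : ℝ :=
  if |a.valMinAbs| < (N : ℤ) then Real.cos (Real.pi / (2 * N) * a.valMinAbs) else 0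

lemma cos_nonneg_of_abs_le {N : ℕ} {k : ℤ} (hk : |k| ≤ (N : ℤ)) :
    0 ≤ Real.cos (Real.pi / (2 * N) * k) := by
  rcases Nat.eq_zero_or_pos N with rfl | hN
  · simp
  have hN' : (0 : ℝ) < N := by exact_mod_cast hN
  have hk' : |(k : ℝ)| ≤ N := by exact_mod_cast hk
  apply Real.cos_nonneg_of_neg_pi_div_two_le_of_le
  · have := (abs_le.1 hk').1
    have h := mul_le_mul_of_nonneg_left this (by positivity : 0 ≤ Real.pi / (2 * N))
    calc -(Real.pi / 2) = Real.pi / (2 * N) * -N := by field_simp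
      _ ≤ _ := h
  · have := (abs_le.1 hk').2
    have h := mul_le_mul_of_nonneg_left this (by positivity : 0 ≤ Real.pi / (2 * N))
    calc _ ≤ Real.pi / (2 * N) * N := h
      _ = Real.pi / 2 := by field_simp

lemma cycleGroundState_nonneg (L N : ℕ) (a : ZMod L) : 0 ≤ cycleGroundState L N a := by
  unfold cycleGroundState
  split_ifs with h
  · exact cos_nonneg_of_abs_le h.le
  · exact le_rfl

lemma cycleGroundState_zero {L N : ℕ} (hN : 1 ≤ N) : cycleGroundState L N 0 = 1 := by
  simp [cycleGroundState, Nat.ne_zero_of_lt hN]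

lemma cos_le_cycleGroundState {L N : ℕ} [NeZero L] (hN : 1 ≤ N) (hNL : 2 * N ≤ L) {k : ℤ}
    (hk : |k| ≤ (N : ℤ)) :
    Real.cos (Real.pi / (2 * N) * k) ≤ cycleGroundState L N (k : ZMod L) := by
  rcases lt_or_eq_of_le hk with h | h
  · have hv : (k : ZMod L).valMinAbs = k := by
      rw [ZMod.valMinAbs_spec]
      rw [abs_lt] at h
      exact ⟨rfl, by constructor <;> omega⟩
    rw [cycleGroundState, hv, if_pos h]
  · have hN' : (N : ℝ) ≠ 0 := by positivity
    have hcos : Real.cos (Real.pi / (2 * N) * k) = 0 := by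
      rw [← Real.cos_abs, abs_mul, abs_of_nonneg (by positivity), ← Int.cast_abs, h,
        Int.cast_natCast, ← Real.cos_pi_div_two]
      congr 1
      field_simp
    rw [hcos]
    exact cycleGroundState_nonneg _ _ _

lemma two_cos_mul_cycleGroundState_le {L N : ℕ} [NeZero L] (hN : 1 ≤ N) (hNL : 2 * N ≤ L)
    (a : ZMod L) :
    2 * Real.cos (Real.pi / (2 * N)) * cycleGroundState L N a ≤
      cycleGroundState L N (a + 1) + cycleGroundState L N (a - 1) := by
  by_cases h : |a.valMinAbs| < (N : ℤ)
  · have h1 := cos_le_cycleGroundState hN hNL (k := a.valMinAbs + 1)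
      (by rw [abs_lt] at h; rw [abs_le]; omega)
    have h2 := cos_le_cycleGroundState hN hNL (k := a.valMinAbs - 1)
      (by rw [abs_lt] at h; rw [abs_le]; omega)
    push_cast [ZMod.coe_valMinAbs] at h1 h2
    rw [mul_add, mul_one, Real.cos_add] at h1
    rw [mul_sub, mul_one, Real.cos_sub] at h2
    have h3 : cycleGroundState L N a = Real.cos (Real.pi / (2 * N) * a.valMinAbs) := if_pos h
    rw [h3]
    linarith
  · rw [cycleGroundState, if_neg h, mul_zero]
    exact add_nonneg (cycleGroundState_nonneg _ _ _) (cycleGroundState_nonneg _ _ _)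

lemma sum_cycleGroundState_sq_le {L N : ℕ} [NeZero L] (hN : 1 ≤ N) :
    ∑ a : ZMod L, cycleGroundState L N a ^ 2 ≤ N := by
  set F : ℤ → ℝ := fun k => Real.cos (Real.pi / (2 * N) * k) ^ 2 with hF
  have hN' : (N : ℝ) ≠ 0 := by positivity
  have hsum : ∑ k ∈ Finset.Ico (-N : ℤ) N, F k = N := by
    rw [← Finset.Ico_union_Ico_eq_Ico (b := 0) (by omega) (by omega),
      Finset.sum_union (Finset.Ico_disjoint_Ico_consecutive _ _ _)]
    have hshift := Finset.sum_Ico_add' F 0 (N : ℤ) (-N : ℤ)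
    rw [zero_add, add_neg_cancel] at hshift
    rw [← hshift, ← Finset.sum_add_distrib]
    have : ∀ k : ℤ, F (k + -N) + F k = 1 := by
      intro k
      have : Real.pi / (2 * N) * ((k + -N : ℤ) : ℝ) = Real.pi / (2 * N) * k - Real.pi / 2 := by
        push_cast
        field_simp
        ring
      simp only [hF, this, Real.cos_sub_pi_div_two, Real.sin_sq_add_cos_sq]
    simp [this]
  have hsupp : ∑ a : ZMod L, cycleGroundState L N a ^ 2 =
      ∑ a ∈ Finset.univ.filter (fun a : ZMod L => |a.valMinAbs| < (N : ℤ)), F a.valMinAbs := by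
    rw [Finset.sum_filter]
    refine Finset.sum_congr rfl fun a _ => ?_
    unfold cycleGroundState
    split_ifs <;> simp [hF]
  rw [hsupp, ← Finset.sum_image (f := F) (g := ZMod.valMinAbs)
    ((ZMod.injective_valMinAbs (n := L)).injOn), ← hsum]
  refine Finset.sum_le_sum_of_subset_of_nonneg ?_ fun k _ _ => sq_nonneg _
  intro k hk
  obtain ⟨a, ha, rfl⟩ := Finset.mem_image.1 hk
  have := abs_lt.1 (Finset.mem_filter.1 ha).2
  exact Finset.mem_Ico.2 ⟨this.1.le, this.2⟩

lemma one_ne_neg_one_of_three_le {L : ℕ} (hL : 3 ≤ L) : (1 : ZMod L) ≠ -1 := by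
  have : Fact (2 < L) := ⟨by omega⟩
  exact (ZMod.neg_one_ne_one (n := L)).symm

lemma isNN_iff_exists_update {d L : ℕ} (y z : Lam d L) :
    isNN y z ↔ ∃ p : Fin d × Bool,
      Function.update y p.1 (y p.1 + if p.2 then 1 else -1) = z := by
  constructor
  · rintro ⟨ν, h | h, ho⟩
    · refine ⟨(ν, false), ?_⟩
      ext i
      by_cases hi : i = ν
      · subst hi; simp [h]
      · simp [hi, ho i hi]
    · refine ⟨(ν, true), ?_⟩
      ext i
      by_cases hi : i = ν
      · subst hi; simp [h]
      · simp [hi, ho i hi]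
  · rintro ⟨⟨ν, b⟩, rfl⟩
    refine ⟨ν, ?_, fun i hi => by simp [hi]⟩
    cases b <;> simp

lemma update_add_injective {d L : ℕ} (hL : 3 ≤ L) (y : Lam d L) :
    Function.Injective fun p : Fin d × Bool =>
      Function.update y p.1 (y p.1 + if p.2 then 1 else -1) := by
  have : Fact (1 < L) := ⟨by omega⟩
  have h1 := one_ne_neg_one_of_three_le hL
  have hne : ∀ b : Bool, (if b then (1 : ZMod L) else -1) ≠ 0 := by
    intro b; cases b <;> simp
  rintro ⟨ν, b⟩ ⟨η, c⟩ h
  have hν : ν = η := by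
    by_contra hdist
    have := congrFun h ν
    simp [hdist] at this
    exact hne b (by simpa using! this)
  subst hν
  have := congrFun h ν
  simp only [Function.update_self, add_right_inj] at this
  cases b <;> cases c <;> simp_all

lemma sum_isNN {d L : ℕ} [NeZero L] (hL : 3 ≤ L) (y : Lam d L) (f : Lam d L → ℝ) :
    ∑ z, (if isNN y z then f z else 0) =
      ∑ ν, (f (Function.update y ν (y ν + 1)) + f (Function.update y ν (y ν - 1))) := by
  have hfil : Finset.univ.filter (fun z => isNN y z) = Finset.univ.image
      (fun p : Fin d × Bool => Function.update y p.1 (y p.1 + if p.2 then 1 else -1)) := by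
    ext z
    simp [isNN_iff_exists_update y z]
  rw [← Finset.sum_filter, hfil, Finset.sum_image (update_add_injective hL y).injOn,
    Fintype.sum_prod_type]
  simp [sub_eq_add_neg]

/-- The product of one-dimensional ground states, centred at `x`. -/
def torusGroundState {d L : ℕ} (N : ℕ) (x y : Lam d L) : ℝ :=
  ∏ ν, cycleGroundState L N (y ν - x ν)

lemma torusGroundState_nonneg {d L : ℕ} (N : ℕ) (x y : Lam d L) : 0 ≤ torusGroundState N x y :=
  Finset.prod_nonneg fun _ _ => cycleGroundState_nonneg _ _ _

lemma torusGroundState_self {d L N : ℕ} (hN : 1 ≤ N) (x : Lam d L) :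
    torusGroundState N x x = 1 := by
  simp [torusGroundState, cycleGroundState_zero hN]

lemma sum_torusGroundState_sq_le {d L N : ℕ} [NeZero L] (hN : 1 ≤ N) (x : Lam d L) :
    ∑ y, torusGroundState N x y ^ 2 ≤ (N : ℝ) ^ d := by
  have h : ∑ y, torusGroundState N x y ^ 2 =
      ∏ ν, ∑ a : ZMod L, cycleGroundState L N (a - x ν) ^ 2 := by
    rw [Finset.prod_univ_sum, Fintype.piFinset_univ]
    simp only [torusGroundState, Finset.prod_pow]
  have h2 : ∀ b : ZMod L, ∑ a : ZMod L, cycleGroundState L N (a - b) ^ 2 ≤ N := by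
    intro b
    exact (Equiv.sum_comp (Equiv.subRight b) fun a => cycleGroundState L N a ^ 2).trans_le
      (sum_cycleGroundState_sq_le hN)
  rw [h]
  calc _ ≤ ∏ _ν : Fin d, (N : ℝ) :=
        Finset.prod_le_prod (fun _ _ => Finset.sum_nonneg fun _ _ => sq_nonneg _) fun ν _ => h2 _
    _ = _ := by simp

lemma torusGroundState_update {d L N : ℕ} (x y : Lam d L) (ν : Fin d) (a : ZMod L) :
    torusGroundState N x (Function.update y ν a) =
      cycleGroundState L N (a - x ν) *
        ∏ i ∈ Finset.univ.erase ν, cycleGroundState L N (y i - x i) := by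
  rw [torusGroundState, ← Finset.mul_prod_erase _ _ (Finset.mem_univ ν), Function.update_self]
  congr 1
  refine Finset.prod_congr rfl fun i hi => ?_
  rw [Function.update_of_ne (Finset.ne_of_mem_erase hi)]

lemma two_cos_mul_torusGroundState_le {d L N : ℕ} [NeZero L] (hL : 3 ≤ L) (hN : 1 ≤ N)
    (hNL : 2 * N ≤ L) (x y : Lam d L) :
    2 * d * Real.cos (Real.pi / (2 * N)) * torusGroundState N x y ≤
      ∑ z, (if isNN y z then torusGroundState N x z else 0) := by
  rw [sum_isNN hL]
  calc _ = ∑ _ν : Fin d, 2 * Real.cos (Real.pi / (2 * N)) * torusGroundState N x y := by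
        simp; ring
    _ ≤ _ := by
      refine Finset.sum_le_sum fun ν _ => ?_
      rw [torusGroundState_update, torusGroundState_update, ← add_mul, torusGroundState,
        ← Finset.mul_prod_erase _ _ (Finset.mem_univ ν), ← mul_assoc]
      refine mul_le_mul_of_nonneg_right ?_
        (Finset.prod_nonneg fun _ _ => cycleGroundState_nonneg _ _ _)
      have := two_cos_mul_cycleGroundState_le hN hNL (y ν - x ν)
      rwa [sub_add_eq_add_sub, sub_right_comm] at this

lemma torusDist_le_natAbs_valMinAbs {L : ℕ} [NeZero L] (a b : ZMod L) :
    torusDist a b ≤ (b - a).valMinAbs.natAbs := by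
  rw [ZMod.valMinAbs_natAbs_eq_min, torusDist, min_comm]
  refine min_le_min le_rfl ?_
  rw [← neg_sub b a, ZMod.neg_val]
  split_ifs <;> omega

lemma distInf_lt_of_torusGroundState_ne_zero {d L N : ℕ} [NeZero L] (hN : 1 ≤ N) {x y : Lam d L}
    (h : torusGroundState N x y ≠ 0) : distInf x y < N := by
  refine (Finset.sup_lt_iff (by simpa using! hN)).2 fun ν _ => ?_
  refine (torusDist_le_natAbs_valMinAbs _ _).trans_lt ?_
  have hν : cycleGroundState L N (y ν - x ν) ≠ 0 :=
    Finset.prod_ne_zero_iff.1 h ν (Finset.mem_univ ν)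
  unfold cycleGroundState at hν
  split_ifs at hν with hlt
  · rw [Int.abs_eq_natAbs] at hlt
    exact_mod_cast hlt
  · exact absurd rfl hν

lemma kappaConst_eq_exp {d : ℕ} (hd : 1 ≤ d) {μ : ℝ} (hμ0 : 0 < μ) {B : ℝ} (hB : 0 < B)
    (hBdef : B = 1 + 2 * Real.log 2 * ((d : ℝ)⁻¹ + 1) + Real.log (4 * d / μ)) :
    kappaConst d μ = Real.exp (-(2 * Real.log 2 +
      d * (2 * Real.log 2 + 1 + Real.log (4 * d / μ) + 2 * Real.log B))) := by
  have hd' : (0 : ℝ) < d := by exact_mod_cast hd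
  have hs : 0 < 4 * d / μ := by positivity
  have h2 : Real.exp (2 * Real.log 2) = 4 := by
    rw [two_mul, Real.exp_add, Real.exp_log two_pos]; norm_num
  have hB2 : Real.exp (2 * Real.log B) = B ^ 2 := by
    rw [two_mul, Real.exp_add, Real.exp_log hB, sq]
  rw [kappaConst, ← hBdef, Real.exp_neg, Real.exp_add, Real.exp_nat_mul, Real.exp_add,
    Real.exp_add, Real.exp_add, h2, hB2, Real.exp_log hs, pow_succ 4, pow_mul 4, pow_mul B]
  simp only [mul_pow, div_pow]
  have h16 : ((4 : ℝ) ^ 2) ^ d = 4 ^ d * 4 ^ d := by rw [← mul_pow]; norm_num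
  rw [h16]
  field_simp

lemma sq_pi_div_mul_le {d s B μ N : ℝ} (hμ0 : 0 < μ) (hs : 1 ≤ s) (hB : 2 ≤ B)
    (hN : 3 / 2 * (B * √s) ≤ N) (hds : d = s * μ / 4) :
    (Real.pi / (2 * N)) ^ 2 * d ≤ 1 / (3 * B - 2) * (μ / 2) := by
  have hpi : Real.pi ^ 2 ≤ 10 := by nlinarith [Real.pi_lt_d2, Real.pi_pos]
  have hB2 : 0 < 3 * B - 2 := by linarith
  have hs0 : 0 < s := by linarith
  have hN0 : 0 < N := lt_of_lt_of_le (by positivity) hN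
  have hNsq : 9 / 4 * (B ^ 2 * s) ≤ N ^ 2 := by
    have h := pow_le_pow_left₀ (by positivity) hN 2
    rw [mul_pow, mul_pow, Real.sq_sqrt hs0.le] at h
    linarith
  have key : Real.pi ^ 2 * (s * (3 * B - 2)) ≤ 8 * N ^ 2 := by
    have h1 : Real.pi ^ 2 * (s * (3 * B - 2)) ≤ 10 * (s * (3 * B - 2)) :=
      mul_le_mul_of_nonneg_right hpi (by positivity)
    have h2 : 10 * (3 * B - 2) ≤ 18 * B ^ 2 := by nlinarith [sq_nonneg (6 * B - 5)]
    have h3 := mul_le_mul_of_nonneg_left h2 hs0.le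
    linarith
  rw [hds, div_pow, div_mul_eq_mul_div, div_mul_eq_mul_div,
    div_le_div_iff₀ (by positivity) hB2]
  have := mul_le_mul_of_nonneg_right key (by positivity : 0 ≤ μ / 4)
  linarith

/-- A length scale at which the box ground state energy is small compared with `μ`, while the
volume of the box is still controlled by `kappaConst`. -/
lemma exists_length_scale {d : ℕ} (hd : 1 ≤ d) {μ : ℝ} (hμ0 : 0 < μ) (hμ4 : μ ≤ 4 * d) :
    ∃ N : ℕ, 1 ≤ N ∧ (N : ℝ) ≤ Mstar d μ ∧ ∃ ε : ℝ, 0 < ε ∧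
      d * (2 - 2 * Real.cos (Real.pi / (2 * N))) ≤ μ / 2 - ε ∧
      kappaConst d μ ≤ Real.exp (-(Real.log (2 * (N : ℝ) ^ d) / ε * μ)) := by
  have hd' : (1 : ℝ) ≤ d := by exact_mod_cast hd
  set s : ℝ := 4 * d / μ with hs
  have hs1 : 1 ≤ s := by rw [hs, le_div_iff₀ hμ0]; linarith
  set B : ℝ := 1 + 2 * Real.log 2 * ((d : ℝ)⁻¹ + 1) + Real.log s with hB
  have hl2 := Real.log_two_gt_d9
  have hl2' := Real.log_two_lt_d9
  have hlogs : 0 ≤ Real.log s := Real.log_nonneg hs1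
  have hdinv : 0 < (d : ℝ)⁻¹ := by positivity
  have hdinv1 : (d : ℝ)⁻¹ ≤ 1 := inv_le_one_of_one_le₀ hd'
  have hBlow : 2 ≤ B := by nlinarith
  set u : ℝ := √s with hu
  have hu1 : 1 ≤ u := Real.one_le_sqrt.2 hs1
  have husq : u ^ 2 = s := Real.sq_sqrt (by linarith)
  have hlogu : Real.log s = 2 * Real.log u := by
    rw [← husq, Real.log_pow]; norm_num
  have hBup : B ≤ 2 + 2 * u := by
    have := Real.log_le_sub_one_of_pos (zero_lt_one.trans_le hu1)
    nlinarith
  have hBu : 2 ≤ B * u := by nlinarith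
  set N : ℕ := ⌊2 * (B * u)⌋₊ with hN
  have hNle : (N : ℝ) ≤ 2 * (B * u) := Nat.floor_le (by linarith)
  have hNge : 3 / 2 * (B * u) ≤ N := by
    have := Nat.lt_floor_add_one (2 * (B * u))
    linarith
  have hN0 : (0 : ℝ) < N := by linarith
  have hN1 : 1 ≤ N := by exact_mod_cast hN0
  have hlogB : Real.log B ≤ B - 1 := Real.log_le_sub_one_of_pos (by linarith)
  have hB2 : 0 < 3 * B - 2 := by linarith
  set δ : ℝ := 1 / (3 * B - 2) with hδ
  have hδ1 : δ < 1 := by rw [hδ, div_lt_one hB2]; linarith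
  have hδ0 : 0 < δ := by positivity
  refine ⟨N, hN1, ?_, μ / 2 * (1 - δ), by nlinarith, ?_, ?_⟩
  · have : Mstar d μ = 12 * u ^ 4 := by
      rw [Mstar, ← hs, ← husq]; ring
    rw [this]
    have h1 : B * u ≤ (2 + 2 * u) * u := mul_le_mul_of_nonneg_right hBup (by linarith)
    have h2 : u ≤ u ^ 2 := by nlinarith
    have h3 : u ^ 2 ≤ u ^ 4 := pow_le_pow_right₀ hu1 (by norm_num)
    nlinarith
  · have hcos := Real.one_sub_sq_div_two_le_cos (x := Real.pi / (2 * N))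
    have hds : (d : ℝ) = s * μ / 4 := by rw [hs]; field_simp
    have hsq := sq_pi_div_mul_le hμ0 hs1 hBlow hNge hds
    rw [← hδ] at hsq
    have hdcos := mul_le_mul_of_nonneg_left hcos (by positivity : (0 : ℝ) ≤ 2 * d)
    linarith
  · rw [kappaConst_eq_exp hd hμ0 (by linarith) hB, Real.exp_le_exp, neg_le_neg_iff,
      Real.log_mul two_ne_zero (by positivity), Real.log_pow, ← hs]
    have hlogN : Real.log N ≤ Real.log 2 + (Real.log B + Real.log u) := by
      rw [← Real.log_mul (by positivity) (by positivity),
        ← Real.log_mul two_ne_zero (by positivity)]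
      exact Real.log_le_log hN0 hNle
    have hε : 0 < μ / 2 * (1 - δ) := by nlinarith
    rw [div_mul_eq_mul_div, div_le_iff₀ hε]
    have hY : Real.log 2 + d * Real.log N ≤
        Real.log 2 + d * (Real.log 2 + (Real.log B + Real.log u)) := by gcongr
    have hdB : d * B = d + 2 * Real.log 2 + 2 * Real.log 2 * d + d * Real.log s := by
      rw [hB]; field_simp; ring
    have hZ : 2 * Real.log 2 + d * (2 * Real.log 2 + 1 + Real.log s + 2 * Real.log B) ≤
        d * (3 * B - 2) := by nlinarith
    have hδZ : δ * (2 * Real.log 2 + d * (2 * Real.log 2 + 1 + Real.log s + 2 * Real.log B)) ≤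
        d := by
      calc _ ≤ δ * (d * (3 * B - 2)) := mul_le_mul_of_nonneg_left hZ hδ0.le
        _ = d := by rw [hδ]; field_simp
    set Z : ℝ := 2 * Real.log 2 + d * (2 * Real.log 2 + 1 + Real.log s + 2 * Real.log B)
      with hZdef
    have hZeq : Z = 2 * (Real.log 2 + d * (Real.log 2 + (Real.log B + Real.log u))) + d := by
      rw [hZdef, hlogu]; ring
    have hfin : 2 * (Real.log 2 + d * Real.log N) ≤ (1 - δ) * Z := by linarith
    calc (Real.log 2 + d * Real.log N) * μ = 2 * (Real.log 2 + d * Real.log N) * (μ / 2) := by ring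
      _ ≤ (1 - δ) * Z * (μ / 2) := mul_le_mul_of_nonneg_right hfin (by positivity)
      _ = Z * (μ / 2 * (1 - δ)) := by ring

lemma Matrix.IsHermitian.exists_sub_sum_le_eigenvalues {n : Type} [Fintype n] [DecidableEq n]
    {X : Matrix n n ℂ} (hX : X.IsHermitian) (i : n) :
    ∃ k, (X k k).re - ∑ j ∈ Finset.univ.erase k, ‖X k j‖ ≤ hX.eigenvalues i := by
  have hev : Module.End.HasEigenvalue (Matrix.toLin' X) ((hX.eigenvalues i : ℝ) : ℂ) := by
    refine Module.End.hasEigenvalue_of_hasEigenvector (x := ⇑(hX.eigenvectorBasis i))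
      ⟨Module.End.mem_eigenspace_iff.2 ?_, ?_⟩
    · rw [Matrix.toLin'_apply, hX.mulVec_eigenvectorBasis]
      rfl
    · exact (WithLp.ofLp_eq_zero 2).ne.2 <| hX.eigenvectorBasis.orthonormal.ne_zero i
  obtain ⟨k, hk⟩ := eigenvalue_mem_ball hev
  refine ⟨k, ?_⟩
  rw [Metric.mem_closedBall, dist_comm, Complex.dist_eq] at hk
  have := (Complex.re_le_norm _).trans hk
  rw [Complex.sub_re, Complex.ofReal_re] at this
  linarith

lemma isNN_comm {d L : ℕ} {y z : Lam d L} : isNN y z ↔ isNN z y := by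
  constructor <;> rintro ⟨ν, h, ho⟩ <;>
    exact ⟨ν, h.symm.imp Eq.symm Eq.symm, fun i hi => (ho i hi).symm⟩

lemma not_isNN_self {d L : ℕ} (hL : 2 ≤ L) (y : Lam d L) : ¬ isNN y y := by
  have : Fact (1 < L) := ⟨by omega⟩
  rintro ⟨ν, h | h, -⟩ <;> simp at h

/-- The real matrix `-Δ_Ω - V`. -/
def domainHamiltonian {d L : ℕ} (Ω : Set (Lam d L)) (V : Lam d L → ℝ) :
    Matrix (Lam d L) (Lam d L) ℝ :=
  Matrix.of fun y z =>
    (if y ∈ Ω ∧ z ∈ Ω then (if y = z then 2 * (d : ℝ) else 0) - (if isNN y z then 1 else 0) else 0)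
      - (if y = z then V y else 0)

lemma domainHamiltonian_map {d L : ℕ} [NeZero L] (Ω : Set (Lam d L)) (V : Lam d L → ℝ) :
    -(proj Ω * lap d L * proj Ω) - Matrix.diagonal (fun z => (V z : ℂ)) =
      (domainHamiltonian Ω V).map (fun r => (r : ℂ)) := by
  ext y z
  rw [Matrix.sub_apply, Matrix.neg_apply, proj, Matrix.mul_diagonal, Matrix.diagonal_mul]
  by_cases hy : y ∈ Ω <;> by_cases hz : z ∈ Ω <;> by_cases hyz : y = z <;>
    by_cases hn : isNN y z <;>
    simp [domainHamiltonian, lap, hy, hz, hyz, hn] <;>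
    simp_all

lemma domainHamiltonian_transpose {d L : ℕ} (Ω : Set (Lam d L)) (V : Lam d L → ℝ) :
    (domainHamiltonian Ω V).transpose = domainHamiltonian Ω V := by
  ext y z
  by_cases hyz : y = z
  · rw [hyz]; rfl
  · simp [domainHamiltonian, hyz, Ne.symm hyz, isNN_comm (y := z), and_comm]

lemma domainHamiltonian_off_diag_nonpos {d L : ℕ} (Ω : Set (Lam d L)) (V : Lam d L → ℝ)
    {y z : Lam d L} (hyz : y ≠ z) : domainHamiltonian Ω V y z ≤ 0 := by
  simp only [domainHamiltonian, Matrix.of_apply, hyz, if_false]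
  split_ifs <;> norm_num

lemma domainHamiltonian_map_isHermitian {d L : ℕ} (Ω : Set (Lam d L)) (V : Lam d L → ℝ) :
    ((domainHamiltonian Ω V).map (fun r => (r : ℂ))).IsHermitian := by
  ext y z
  have : domainHamiltonian Ω V z y = domainHamiltonian Ω V y z :=
    congrFun (congrFun (domainHamiltonian_transpose Ω V) y) z
  simp [Matrix.conjTranspose_apply, this]

lemma neg_le_eigenvalues_domainHamiltonian {d L : ℕ} [NeZero L] (hL : 3 ≤ L) {Ω : Set (Lam d L)}
    {V : Lam d L → ℝ} {μ : ℝ} (hμ : 0 ≤ μ) (hV : ∀ y ∈ Ω, V y ≤ μ) (hV0 : ∀ y ∉ Ω, V y = 0)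
    (i : Lam d L) : -μ ≤ (domainHamiltonian_map_isHermitian Ω V).eigenvalues i := by
  obtain ⟨k, hk⟩ := (domainHamiltonian_map_isHermitian Ω V).exists_sub_sum_le_eigenvalues i
  refine le_trans ?_ hk
  rw [Matrix.map_apply, Complex.ofReal_re]
  by_cases hkΩ : k ∈ Ω
  · have hsum : ∑ j ∈ Finset.univ.erase k,
        ‖(domainHamiltonian Ω V).map (fun r => (r : ℂ)) k j‖ ≤ 2 * d := by
      calc _ ≤ ∑ j ∈ Finset.univ.erase k, (if isNN k j then (1 : ℝ) else 0) := by
            refine Finset.sum_le_sum fun j hj => ?_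
            have hkj : k ≠ j := (Finset.ne_of_mem_erase hj).symm
            rw [Matrix.map_apply, Complex.norm_real]
            simp only [domainHamiltonian, Matrix.of_apply, hkj, if_false]
            split_ifs <;> norm_num
        _ ≤ ∑ j, (if isNN k j then (1 : ℝ) else 0) :=
            Finset.sum_le_sum_of_subset_of_nonneg (Finset.subset_univ _)
              fun _ _ _ => by split_ifs <;> norm_num
        _ = 2 * d := by
            rw [sum_isNN hL k fun _ => 1]
            simp; ring
    have hdiag : domainHamiltonian Ω V k k = 2 * d - V k := by
      simp [domainHamiltonian, hkΩ, not_isNN_self (by omega : 2 ≤ L)]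
    linarith [hV k hkΩ]
  · have h0 : ∀ j, domainHamiltonian Ω V k j = 0 := by
      intro j
      simp [domainHamiltonian, hkΩ, hV0 k hkΩ]
    simp [h0, hμ]

lemma domainHamiltonian_mulVec_le {d L : ℕ} [NeZero L] {Ω : Set (Lam d L)} {V : Lam d L → ℝ}
    {μ ε τ : ℝ} {f : Lam d L → ℝ} (hV : ∀ y ∈ Ω, μ / 2 ≤ V y) (hf : ∀ y, 0 ≤ f y)
    (hsupp : ∀ y ∉ Ω, f y = 0) (hV0 : ∀ y ∉ Ω, V y = 0)
    (hT : ∀ y, τ * f y ≤ ∑ z, (if isNN y z then f z else 0)) (hτ : 2 * d - τ ≤ μ / 2 - ε)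
    (y : Lam d L) : ∑ z, domainHamiltonian Ω V y z * f z ≤ -ε * f y := by
  by_cases hy : y ∈ Ω
  · have h : ∀ z, domainHamiltonian Ω V y z * f z =
        (if y = z then (2 * d - V y) * f z else 0) - (if isNN y z then f z else 0) := by
      intro z
      by_cases hz : z ∈ Ω
      · simp only [domainHamiltonian, Matrix.of_apply, hy, hz, and_self, if_true]
        split_ifs <;> ring
      · simp [hsupp z hz]
    simp only [h, Finset.sum_sub_distrib, Finset.sum_ite_eq, Finset.mem_univ, if_true]
    nlinarith [hT y, mul_le_mul_of_nonneg_right (hV y hy) (hf y),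
      mul_le_mul_of_nonneg_right hτ (hf y)]
  · have h : ∀ z, domainHamiltonian Ω V y z = 0 := by
      intro z
      simp [domainHamiltonian, hy, hV0 y hy]
    simp [h, hsupp y hy]

/-- Lemma 3.3, electron density in the bulk: for `0 < μ ≤ 4d`,
`M = 12(4d/μ)²`, `L ≥ 2M`, a potential `μ/2 ≤ V ≤ μ` on `Ω` (zero outside), and `χ` the
spectral projection of `-Δ_Ω - V` onto its negative eigenvalues, the density `χ_{x,x}` is
at least `κ(μ)` at every `x ∈ Ω` at `ℓ^∞`-distance `> 2M` from `Λ∖Ω`. -/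
theorem bulk_density_lower_bound (d L : ℕ) (hd : 1 ≤ d) [NeZero L]
    (hLeven : Even L) (μ : ℝ) (hμ0 : 0 < μ) (hμ4 : μ ≤ 4 * d)
    (hL : 2 * Mstar d μ ≤ (L : ℝ))
    (Ω : Set (Lam d L)) (V : Lam d L → ℝ)
    (hV : ∀ x ∈ Ω, μ / 2 ≤ V x ∧ V x ≤ μ) (hV0 : ∀ x ∉ Ω, V x = 0)
    (x : Lam d L) (hx : x ∈ Ω)
    (hxfar : ∀ y, y ∉ Ω → 2 * Mstar d μ < (distInf x y : ℝ)) :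
    kappaConst d μ ≤
      ((specProjLt (-(proj Ω * lap d L * proj Ω)
          - Matrix.diagonal (fun z => (V z : ℂ))) 0) x x).re := by
  obtain ⟨N, hN1, hNM, ε, hε, hcos, hκ⟩ := exists_length_scale hd hμ0 hμ4
  have hM : 12 ≤ Mstar d μ := by
    have : 1 ≤ 4 * d / μ := by rwa [le_div_iff₀ hμ0, one_mul]
    rw [Mstar]
    nlinarith
  have hL3 : 3 ≤ L := by
    have : (3 : ℝ) ≤ L := by linarith
    exact_mod_cast this
  have hNL : 2 * N ≤ L := by
    have : (2 * N : ℝ) ≤ L := by linarith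
    exact_mod_cast this
  have hsupp : ∀ y ∉ Ω, torusGroundState N x y = 0 := by
    intro y hy
    by_contra hne
    have h1 : (distInf x y : ℝ) < N := by
      exact_mod_cast distInf_lt_of_torusGroundState_ne_zero hN1 hne
    linarith [hxfar y hy]
  have hN0 : (1 : ℝ) ≤ N := by exact_mod_cast hN1
  have hA : (1 : ℝ) ≤ (N : ℝ) ^ d := one_le_pow₀ hN0
  have hlog : 0 ≤ Real.log (2 * (N : ℝ) ^ d) := Real.log_nonneg (by linarith)
  have hmain := exp_mul_le_specProjLt (domainHamiltonian_map_isHermitian Ω V)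
    (domainHamiltonian_transpose Ω V) (fun _ _ => domainHamiltonian_off_diag_nonpos Ω V) hε.le
    (neg_le_eigenvalues_domainHamiltonian hL3 hμ0.le (fun y hy => (hV y hy).2) hV0)
    (torusGroundState_nonneg N x)
    (domainHamiltonian_mulVec_le (fun y hy => (hV y hy).1) (torusGroundState_nonneg N x) hsupp hV0
      (two_cos_mul_torusGroundState_le hL3 hN1 hNL x) (by linarith))
    (torusGroundState_self hN1 x) (div_nonneg hlog hε.le)
  rw [domainHamiltonian_map]
  set χ : ℝ := (specProjLt ((domainHamiltonian Ω V).map (fun r => (r : ℂ))) 0 x x).re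
  set E : ℝ := Real.exp (Real.log (2 * (N : ℝ) ^ d) / ε * μ)
  rw [div_mul_cancel₀ _ hε.ne', Real.exp_log (by linarith)] at hmain
  have hS := sum_torusGroundState_sq_le hN1 x
  have hS0 : 0 ≤ ∑ y, torusGroundState N x y ^ 2 := Finset.sum_nonneg fun _ _ => sq_nonneg _
  have hpos : 0 ≤ 1 + E * χ := by
    by_contra hneg
    nlinarith [mul_nonpos_of_nonneg_of_nonpos hS0 (not_le.1 hneg).le]
  have hEχ : 1 ≤ E * χ := by
    have := hmain.trans (mul_le_mul_of_nonneg_right hS hpos)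
    have h2 : 2 ≤ 1 + E * χ := le_of_mul_le_mul_left (by linarith) (zero_lt_one.trans_le hA)
    linarith
  refine hκ.trans ?_
  rw [Real.exp_neg]
  exact (inv_le_iff_one_le_mul₀' (Real.exp_pos _)).2 hEχ
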